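/- Let S be a semigroup and w : S → (0,∞) a weight function (i.e., w(st) ≤ w(s)w(t) for all s, t ∈ S). If the Banach algebra ℓ¹(S) with convolution product is Arens regular, then the weighted algebra ℓ¹(S, w) is Arens regular. -/

import Mathlib

/-- The first Arens product data: for `n` in the bidual and `f` in the dual of a
normed algebra `B`, the functional `n · f : a ↦ n (f · a)` where `(f · a)(b) = f (a * b)`. -/
noncomputable def arensL (B : Type*) [NonUnitalNormedRing B] [NormedSpace ℂ B]
    [SMulCommClass ℂ B B] [IsScalarTower ℂ B B]
    (n : (B →L[ℂ] ℂ) →L[ℂ] ℂ) (f : B →L[ℂ] ℂ) : B →L[ℂ] ℂ :=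
  n.comp ((ContinuousLinearMap.compL ℂ B B ℂ f).comp (ContinuousLinearMap.mul ℂ B))

/-- The second Arens product data: for `f` in the dual and `m` in the bidual of a
normed algebra `B`, the functional `f · m : a ↦ m (a · f)` where `(a · f)(b) = f (b * a)`. -/
noncomputable def arensR (B : Type*) [NonUnitalNormedRing B] [NormedSpace ℂ B]
    [SMulCommClass ℂ B B] [IsScalarTower ℂ B B]
    (f : B →L[ℂ] ℂ) (m : (B →L[ℂ] ℂ) →L[ℂ] ℂ) : B →L[ℂ] ℂ :=
  m.comp ((ContinuousLinearMap.compL ℂ B B ℂ f).comp (ContinuousLinearMap.mul ℂ B).flip)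

/-- A normed algebra `B` is Arens regular if the first Arens product
`(m □ n)(f) = m (n · f)` and the second Arens product `(m ◇ n)(f) = n (f · m)`
coincide on the bidual `B**`. -/
def ArensRegular (B : Type*) [NonUnitalNormedRing B] [NormedSpace ℂ B]
    [SMulCommClass ℂ B B] [IsScalarTower ℂ B B] : Prop :=
  ∀ (m n : (B →L[ℂ] ℂ) →L[ℂ] ℂ) (f : B →L[ℂ] ℂ),
    m (arensL B n f) = n (arensR B f m)

/-- `B` is a realization of the weighted convolution algebra `ℓ¹(S, w)`:
`δ : S → B` is multiplicative (`δ s * δ t = δ (s * t)`), finite linear combinations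
`∑ c_s δ s` have norm `∑ |c_s| w s`, and they are dense in `B`. -/
def IsWeightedL1 (S : Type*) [Semigroup S] (w : S → ℝ)
    (B : Type*) [NonUnitalNormedRing B] [NormedSpace ℂ B] (δ : S → B) : Prop :=
  (∀ s t : S, δ s * δ t = δ (s * t)) ∧
  (∀ x : S →₀ ℂ, ‖x.sum fun s c => c • δ s‖ = x.sum fun s c => ‖c‖ * w s) ∧
  DenseRange (fun x : S →₀ ℂ => x.sum fun s c => c • δ s)


open Filter Topology

theorem exists_seq_of_forall_list {α : Type*} (P : α → Prop) (R : List α → α → Prop)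
    (h : ∀ l : List α, (∀ x ∈ l, P x) → ∃ y, P y ∧ R l y) :
    ∃ f : ℕ → α, ∀ n, P (f n) ∧ R ((List.range n).map f) (f n) := by
  classical
  have hne : Nonempty α := (h [] (by simp)).nonempty
  have h' : ∀ l : List α, ∃ y, (∀ x ∈ l, P x) → P y ∧ R l y := fun l => by
    by_cases hl : ∀ x ∈ l, P x
    · obtain ⟨y, hy⟩ := h l hl
      exact ⟨y, fun _ => hy⟩
    · exact ⟨hne.some, fun hl' => absurd hl' hl⟩
  choose y hy using h'
  let g : ℕ → List α := fun n => Nat.rec [] (fun _ l => l ++ [y l]) n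
  have hg : ∀ n, g n = (List.range n).map (fun k => y (g k)) := by
    intro n
    induction n with
    | zero => rfl
    | succ n ih =>
      rw [List.range_succ, List.map_append, ← ih]
      rfl
  have hP : ∀ n, ∀ x ∈ g n, P x := by
    intro n
    induction n with
    | zero => intro x hx; simp [g] at hx
    | succ n ih =>
      intro x hx
      have hx' : x ∈ g n ++ [y (g n)] := hx
      rcases List.mem_append.1 hx' with hx' | hx'
      · exact ih x hx'
      · rw [List.mem_singleton.1 hx']
        exact (hy _ ih).1
  refine ⟨fun n => y (g n), fun n => ?_⟩
  rw [← hg n]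
  exact hy _ (hP n)

theorem eventually_forall_mem_list {α β : Type*} {F : Filter β} {l : List α}
    {r : α → β → Prop} (h : ∀ x ∈ l, ∀ᶠ s in F, r x s) : ∀ᶠ s in F, ∀ x ∈ l, r x s :=
  (eventually_all_finite (List.finite_toSet l)).2 h

section IteratedLimits

variable {S T U : Type*} (μ : S → T → U) (p : Ultrafilter S) (q : Ultrafilter T)

/-- No two sequences `u`, `v` have the upper triangle `μ (u n) (v m)`, `n < m`, disjoint from the
lower triangle `n > m`. -/
def TrianglesMeet : Prop :=
  ∀ (u : ℕ → S) (v : ℕ → T), ∃ n m k l, n < m ∧ l < k ∧ μ (u n) (v m) = μ (u k) (v l)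

/-- The two iterated images of ultrafilters under `μ` coincide. -/
def IteratedImagesEq : Prop :=
  ∀ C : Set U, (∀ᶠ s in p, ∀ᶠ t in q, μ s t ∈ C) ↔ ∀ᶠ t in q, ∀ᶠ s in p, μ s t ∈ C

/-- Eventually, in both orders, `μ s t` depends on its first argument only. -/
def EventuallyLeft : Prop :=
  ∃ a : S → U, (∀ᶠ s in p, ∀ᶠ t in q, μ s t = a s) ∧ ∀ᶠ t in q, ∀ᶠ s in p, μ s t = a s

variable {μ p q}

theorem TrianglesMeet.flip (h : TrianglesMeet μ) : TrianglesMeet (flip μ) := by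
  intro u v
  obtain ⟨n, m, k, l, hnm, hlk, he⟩ := h v u
  exact ⟨l, k, m, n, hlk, hnm, he.symm⟩

theorem IteratedImagesEq.flip (h : IteratedImagesEq μ p q) : IteratedImagesEq (flip μ) q p :=
  fun C => (h C).symm

theorem exists_eventually_eq_or (μ : S → T → U) (p : Ultrafilter S) (q : Ultrafilter T) :
    (∃ a : S → U, ∀ᶠ s in p, ∀ᶠ t in q, μ s t = a s) ∨
      ∀ᶠ s in p, ∀ c, ∀ᶠ t in q, μ s t ≠ c := by
  by_cases h : ∀ᶠ s in p, ∃ c, ∀ᶠ t in q, μ s t = c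
  · left
    obtain ⟨s, c, -⟩ := h.exists
    have : ∀ s, ∃ c', (∃ c, ∀ᶠ t in q, μ s t = c) → ∀ᶠ t in q, μ s t = c' := fun s => by
      by_cases hs : ∃ c, ∀ᶠ t in q, μ s t = c
      · exact hs.imp fun c hc _ => hc
      · exact ⟨c, fun h => absurd h hs⟩
    choose a ha using this
    exact ⟨a, h.mono fun s hs => ha s hs⟩
  · right
    refine (Ultrafilter.eventually_not.2 h).mono fun s hs c => ?_
    exact Ultrafilter.eventually_not.2 fun hc => hs ⟨c, hc⟩

theorem eventuallyLeft_of_right_avoids (hT : TrianglesMeet μ) (hI : IteratedImagesEq μ p q)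
    {a : S → U} (ha : ∀ᶠ s in p, ∀ᶠ t in q, μ s t = a s)
    (hq : ∀ᶠ t in q, ∀ c, ∀ᶠ s in p, μ s t ≠ c) : EventuallyLeft μ p q := by
  refine ⟨a, ha, ?_⟩
  by_contra hcon
  replace hcon : ∀ᶠ t in q, ∀ᶠ s in p, μ s t ≠ a s :=
    (Ultrafilter.eventually_not.2 hcon).mono fun t ht => Ultrafilter.eventually_not.2 ht
  have hav : ∀ c, ∀ᶠ s in p, a s ≠ c := by
    intro c
    refine Ultrafilter.eventually_not.2 fun hc => ?_
    have h1 : ∀ᶠ s in p, ∀ᶠ t in q, μ s t ∈ ({c} : Set U) := by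
      filter_upwards [ha, hc] with s h1 h2
      exact h1.mono fun t ht => by simp [ht, h2]
    obtain ⟨t, ht1, ht2⟩ := (((hI {c}).1 h1).and hq).exists
    obtain ⟨s, hs1, hs2⟩ := (ht1.and (ht2 c)).exists
    exact hs2 hs1
  obtain ⟨f, hf⟩ := exists_seq_of_forall_list
    (fun x : S × T => (∀ᶠ t in q, μ x.1 t = a x.1) ∧ (∀ c, ∀ᶠ s in p, μ s x.2 ≠ c) ∧
      ∀ᶠ s in p, μ s x.2 ≠ a s)
    (fun l y => (∀ x ∈ l, μ x.1 y.2 = a x.1) ∧ (∀ x ∈ l, ∀ z ∈ l, μ y.1 x.2 ≠ a z.1) ∧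
      (∀ x ∈ l, μ y.1 x.2 ≠ a y.1) ∧ ∀ x ∈ l, ∀ z ∈ l, a y.1 ≠ μ x.1 z.2) (by
    intro l hl
    obtain ⟨t, ⟨ht1, ht2⟩, ht3⟩ := ((hq.and hcon).and
      (eventually_forall_mem_list fun x hx => (hl x hx).1)).exists
    have e1 : ∀ᶠ s in p, ∀ x ∈ l, ∀ z ∈ l, μ s x.2 ≠ a z.1 :=
      eventually_forall_mem_list fun x hx => eventually_forall_mem_list fun z _ =>
        (hl x hx).2.1 _
    have e2 : ∀ᶠ s in p, ∀ x ∈ l, μ s x.2 ≠ a s :=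
      eventually_forall_mem_list fun x hx => (hl x hx).2.2
    have e3 : ∀ᶠ s in p, ∀ x ∈ l, ∀ z ∈ l, a s ≠ μ x.1 z.2 :=
      eventually_forall_mem_list fun x _ => eventually_forall_mem_list fun z _ => hav _
    obtain ⟨s, ⟨⟨hs0, hs1⟩, hs2⟩, hs3⟩ := (((ha.and e1).and e2).and e3).exists
    exact ⟨(s, t), ⟨hs0, ht1, ht2⟩, ht3, hs1, hs2, hs3⟩)
  have hm : ∀ {i j}, i < j → f i ∈ (List.range j).map f := fun {i j} h =>
    List.mem_map_of_mem (List.mem_range.2 h)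
  obtain ⟨n, m, k, l, hnm, hlk, he⟩ := hT (fun i => (f i).1) (fun i => (f i).2)
  have h1 : μ (f n).1 (f m).2 = a (f n).1 := (hf m).2.1 _ (hm hnm)
  rw [h1] at he
  rcases lt_trichotomy n k with h | h | h
  · exact (hf k).2.2.1 _ (hm hlk) _ (hm h) he.symm
  · subst h
    exact (hf n).2.2.2.1 _ (hm hlk) he.symm
  · exact (hf n).2.2.2.2 _ (hm h) _ (hm (hlk.trans h)) he

theorem not_both_avoid (hT : TrianglesMeet μ) (hp : ∀ᶠ s in p, ∀ c, ∀ᶠ t in q, μ s t ≠ c)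
    (hq : ∀ᶠ t in q, ∀ c, ∀ᶠ s in p, μ s t ≠ c) : False := by
  obtain ⟨f, hf⟩ := exists_seq_of_forall_list
    (fun x : S × T => (∀ c, ∀ᶠ t in q, μ x.1 t ≠ c) ∧ ∀ c, ∀ᶠ s in p, μ s x.2 ≠ c)
    (fun l y => (∀ x ∈ l, ∀ z ∈ l, ∀ z' ∈ l, μ x.1 y.2 ≠ μ z.1 z'.2) ∧
      (∀ x ∈ l, ∀ z ∈ l, ∀ z' ∈ l, μ y.1 x.2 ≠ μ z.1 z'.2) ∧
      ∀ x ∈ l, ∀ z ∈ l, μ x.1 y.2 ≠ μ y.1 z.2) (by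
    intro l hl
    have e1 : ∀ᶠ s in p, ∀ x ∈ l, ∀ z ∈ l, ∀ z' ∈ l, μ s x.2 ≠ μ z.1 z'.2 :=
      eventually_forall_mem_list fun x hx => eventually_forall_mem_list fun z _ =>
        eventually_forall_mem_list fun z' _ => (hl x hx).2 _
    obtain ⟨s, hs, hs1⟩ := (hp.and e1).exists
    have e2 : ∀ᶠ t in q, ∀ x ∈ l, ∀ z ∈ l, ∀ z' ∈ l, μ x.1 t ≠ μ z.1 z'.2 :=
      eventually_forall_mem_list fun x hx => eventually_forall_mem_list fun z _ =>
        eventually_forall_mem_list fun z' _ => (hl x hx).1 _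
    have e3 : ∀ᶠ t in q, ∀ x ∈ l, ∀ z ∈ l, μ x.1 t ≠ μ s z.2 :=
      eventually_forall_mem_list fun x hx => eventually_forall_mem_list fun z _ => (hl x hx).1 _
    obtain ⟨t, ⟨ht, ht2⟩, ht3⟩ := ((hq.and e2).and e3).exists
    exact ⟨(s, t), ⟨hs, ht⟩, ht2, hs1, ht3⟩)
  have hm : ∀ {i j}, i < j → f i ∈ (List.range j).map f := fun {i j} h =>
    List.mem_map_of_mem (List.mem_range.2 h)
  obtain ⟨n, m, k, l, hnm, hlk, he⟩ := hT (fun i => (f i).1) (fun i => (f i).2)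
  rcases lt_trichotomy m k with h | h | h
  · exact (hf k).2.2.1 _ (hm hlk) _ (hm (hnm.trans h)) _ (hm h) he.symm
  · subst h
    exact (hf m).2.2.2 _ (hm hnm) _ (hm hlk) he
  · exact (hf m).2.1 _ (hm hnm) _ (hm h) _ (hm (hlk.trans h)) he

theorem eventuallyLeft_or_of_both_constant (hT : TrianglesMeet μ) {a : S → U} {b : T → U}
    (ha : ∀ᶠ s in p, ∀ᶠ t in q, μ s t = a s) (hb : ∀ᶠ t in q, ∀ᶠ s in p, μ s t = b t) :
    EventuallyLeft μ p q ∨ EventuallyLeft (flip μ) q p := by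
  by_contra! hcon
  have c1 : ∀ᶠ t in q, ∀ᶠ s in p, b t ≠ a s := by
    have := fun h => hcon.1 ⟨a, ha, h⟩
    filter_upwards [Ultrafilter.eventually_not.2 this, hb] with t h1 h2
    filter_upwards [Ultrafilter.eventually_not.2 h1, h2] with s h3 h4
    rwa [← h4]
  have c2 : ∀ᶠ s in p, ∀ᶠ t in q, b t ≠ a s := by
    have := fun h => hcon.2 ⟨b, hb, h⟩
    filter_upwards [Ultrafilter.eventually_not.2 this, ha] with s h1 h2
    filter_upwards [Ultrafilter.eventually_not.2 h1, h2] with t h3 h4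
    rw [← h4]
    exact fun h => h3 h.symm
  obtain ⟨f, hf⟩ := exists_seq_of_forall_list
    (fun x : S × T => ((∀ᶠ t in q, μ x.1 t = a x.1) ∧ ∀ᶠ s in p, μ s x.2 = b x.2) ∧
      (∀ᶠ s in p, b x.2 ≠ a s) ∧ (∀ᶠ t in q, b t ≠ a x.1) ∧ b x.2 ≠ a x.1)
    (fun l y => ∀ x ∈ l, (μ x.1 y.2 = a x.1 ∧ b y.2 ≠ a x.1) ∧
      μ y.1 x.2 = b x.2 ∧ b x.2 ≠ a y.1) (by
    intro l hl
    have e1 : ∀ᶠ s in p, ∀ x ∈ l, μ s x.2 = b x.2 ∧ b x.2 ≠ a s :=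
      eventually_forall_mem_list fun x hx => (hl x hx).1.2.and (hl x hx).2.1
    obtain ⟨s, ⟨hs, hs1⟩, hs2⟩ := ((ha.and e1).and c2).exists
    have e2 : ∀ᶠ t in q, ∀ x ∈ l, μ x.1 t = a x.1 ∧ b t ≠ a x.1 :=
      eventually_forall_mem_list fun x hx => (hl x hx).1.1.and (hl x hx).2.2.1
    obtain ⟨t, ⟨⟨ht, ht1⟩, ht2⟩, ht3⟩ := (((hb.and e2).and c1).and hs2).exists
    exact ⟨(s, t), ⟨⟨hs, ht⟩, ht2, hs2, ht3⟩, fun x hx => ⟨ht1 x hx, hs1 x hx⟩⟩)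
  have hm : ∀ {i j}, i < j → f i ∈ (List.range j).map f := fun {i j} h =>
    List.mem_map_of_mem (List.mem_range.2 h)
  obtain ⟨n, m, k, l, hnm, hlk, he⟩ := hT (fun i => (f i).1) (fun i => (f i).2)
  have h1 : μ (f n).1 (f m).2 = a (f n).1 := ((hf m).2 _ (hm hnm)).1.1
  have h2 : μ (f k).1 (f l).2 = b (f l).2 := ((hf k).2 _ (hm hlk)).2.1
  rw [h1, h2] at he
  rcases lt_trichotomy n l with h | h | h
  · exact ((hf l).2 _ (hm h)).1.2 he.symm
  · subst h
    exact (hf n).1.2.2.2 he.symm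
  · exact ((hf n).2 _ (hm h)).2.2 he.symm

theorem eventuallyLeft_or_flip (hT : TrianglesMeet μ) (hI : IteratedImagesEq μ p q) :
    EventuallyLeft μ p q ∨ EventuallyLeft (flip μ) q p := by
  rcases exists_eventually_eq_or μ p q with ⟨a, ha⟩ | hp <;>
    rcases exists_eventually_eq_or (flip μ) q p with ⟨b, hb⟩ | hq
  · exact eventuallyLeft_or_of_both_constant hT ha hb
  · exact .inl (eventuallyLeft_of_right_avoids hT hI ha hq)
  · exact .inr (eventuallyLeft_of_right_avoids hT.flip hI.flip hb hp)
  · exact (not_both_avoid hT hp hq).elim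

theorem eventually_eq_zero_of_mul_bounded {u : S → ℂ} {v : T → ℂ} {M : ℝ}
    (h : ∀ᶠ s in p, ∀ᶠ t in q, ‖u s * v t‖ ≤ M) (hv : ¬ ∃ N, ∀ᶠ t in q, ‖v t‖ ≤ N) :
    ∀ᶠ s in p, u s = 0 := by
  refine h.mono fun s hs => ?_
  by_contra hu
  refine hv ⟨M / ‖u s‖, hs.mono fun t ht => ?_⟩
  rw [le_div_iff₀ (norm_pos_iff.2 hu), mul_comm, ← norm_mul]
  exact ht

theorem exists_tendsto_of_eventually_norm_le {α : Type*} {r : Ultrafilter α} {v : α → ℂ} {N : ℝ}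
    (h : ∀ᶠ t in r, ‖v t‖ ≤ N) : ∃ c, Tendsto v r (𝓝 c) := by
  obtain ⟨c, -, hc⟩ := (isCompact_closedBall (0 : ℂ) N).ultrafilter_le_nhds (r.map v)
    (Filter.le_principal_iff.2 (h.mono fun t ht => by simpa using ht))
  exact ⟨c, hc⟩

/-- Bounded functions that eventually factor have equal iterated limits. -/
theorem iterated_limits_eq_of_mul {Φ : S → T → ℂ} {M : ℝ} (hM : ∀ s t, ‖Φ s t‖ ≤ M)
    {u : S → ℂ} {v : T → ℂ} (h1 : ∀ᶠ s in p, ∀ᶠ t in q, Φ s t = u s * v t)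
    (h2 : ∀ᶠ t in q, ∀ᶠ s in p, Φ s t = u s * v t)
    {α : S → ℂ} {β : T → ℂ} {a b : ℂ} (hα : ∀ s, Tendsto (Φ s) q (𝓝 (α s)))
    (hβ : ∀ t, Tendsto (fun s => Φ s t) p (𝓝 (β t))) (ha : Tendsto α p (𝓝 a))
    (hb : Tendsto β q (𝓝 b)) : a = b := by
  suffices key : ∃ c : ℂ, ∃ f : S → ℂ, ∃ g : T → ℂ,
      (∀ᶠ s in p, Tendsto (fun t => u s * v t) q (𝓝 (f s))) ∧
      (∀ᶠ t in q, Tendsto (fun s => u s * v t) p (𝓝 (g t))) ∧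
      Tendsto f p (𝓝 c) ∧ Tendsto g q (𝓝 c) by
    obtain ⟨c, f, g, hf, hg, hfc, hgc⟩ := key
    have e1 : α =ᶠ[p] f := by
      filter_upwards [h1, hf] with s hs hfs
      exact tendsto_nhds_unique (hα s) (hfs.congr' (hs.mono fun t ht => ht.symm))
    have e2 : β =ᶠ[q] g := by
      filter_upwards [h2, hg] with t ht hgt
      exact tendsto_nhds_unique (hβ t) (hgt.congr' (ht.mono fun t ht => ht.symm))
    rw [tendsto_nhds_unique ha (hfc.congr' e1.symm), tendsto_nhds_unique hb (hgc.congr' e2.symm)]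
  have hu0 : (¬ ∃ N, ∀ᶠ t in q, ‖v t‖ ≤ N) → ∀ᶠ s in p, u s = 0 :=
    eventually_eq_zero_of_mul_bounded (M := M)
      (h1.mono fun s hs => hs.mono fun t ht => ht ▸ hM s t)
  have hv0 : (¬ ∃ N, ∀ᶠ s in p, ‖u s‖ ≤ N) → ∀ᶠ t in q, v t = 0 :=
    eventually_eq_zero_of_mul_bounded (M := M)
      (h2.mono fun t ht => ht.mono fun s hs => mul_comm (u s) (v t) ▸ hs ▸ hM s t)
  by_cases hv : ∃ N, ∀ᶠ t in q, ‖v t‖ ≤ N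
  · by_cases hu : ∃ N, ∀ᶠ s in p, ‖u s‖ ≤ N
    · obtain ⟨c, hc⟩ := exists_tendsto_of_eventually_norm_le hv.choose_spec
      obtain ⟨d, hd⟩ := exists_tendsto_of_eventually_norm_le hu.choose_spec
      exact ⟨d * c, fun s => u s * c, fun t => d * v t, .of_forall fun s => hc.const_mul _,
        .of_forall fun t => hd.mul_const _, hd.mul_const _, hc.const_mul _⟩
    · refine ⟨0, 0, 0, .of_forall fun s => ?_, ?_, tendsto_const_nhds, tendsto_const_nhds⟩
      · exact tendsto_const_nhds.congr' ((hv0 hu).mono fun t ht => by simp [ht])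
      · exact (hv0 hu).mono fun t ht => by simp [ht]
  · refine ⟨0, 0, 0, ?_, .of_forall fun s => ?_, tendsto_const_nhds, tendsto_const_nhds⟩
    · exact (hu0 hv).mono fun t ht => by simp [ht]
    · exact tendsto_const_nhds.congr' ((hu0 hv).mono fun t ht => by simp [ht])

end IteratedLimits

section SequenceFromClosure

variable {P K : Type*} [TopologicalSpace K] [CompactSpace K]

theorem exists_finset_approx {Φ : P → K → ℂ} (hK : ∀ m, Continuous (Φ m)) (l : List P) {ε : ℝ}
    (hε : 0 < ε) : ∃ T : Finset K, ∀ k, ∃ t ∈ T, ∀ m ∈ l, ‖Φ m t - Φ m k‖ < ε := by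
  have hopen : ∀ t : K, IsOpen {k | ∀ m ∈ l, ‖Φ m t - Φ m k‖ < ε} := fun t => by
    have : {k | ∀ m ∈ l, ‖Φ m t - Φ m k‖ < ε} = ⋂ m ∈ {m | m ∈ l}, {k | ‖Φ m t - Φ m k‖ < ε} := by
      ext; simp
    rw [this]
    refine (List.finite_toSet l).isOpen_biInter fun m _ => ?_
    exact isOpen_lt (continuous_const.sub (hK m)).norm continuous_const
  obtain ⟨T, hT⟩ := isCompact_univ.elim_finite_subcover _ hopen
    (fun k _ => Set.mem_iUnion.2 ⟨k, fun m _ => by simpa using hε⟩)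
  refine ⟨T, fun k => ?_⟩
  obtain ⟨t, ht, hk⟩ := Set.mem_iUnion₂.1 (hT (Set.mem_univ k))
  exact ⟨t, ht, hk⟩

/-- For a separately continuous function on a product of compact spaces, a point in the closure of
`E` is a limit of a sequence in `E` as far as pointwise convergence on `K` is concerned. -/
theorem exists_seq_tendsto_of_mem_closure [TopologicalSpace P] [CompactSpace P]
    {Φ : P → K → ℂ} (hK : ∀ m, Continuous (Φ m))
    (hP : ∀ k, Continuous fun m => Φ m k) {E : Set P} {m₀ : P} (hm₀ : m₀ ∈ closure E) :
    ∃ e : ℕ → P, (∀ n, e n ∈ E) ∧ ∀ k, Tendsto (fun n => Φ (e n) k) atTop (𝓝 (Φ m₀ k)) := by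
  have hpos : ∀ n : ℕ, (0 : ℝ) < 1 / ((n : ℝ) + 1) := fun n => Nat.one_div_pos_of_nat
  have hT := fun l : List P => exists_finset_approx hK (m₀ :: l) (hpos l.length)
  choose T hT using hT
  obtain ⟨e, he⟩ := exists_seq_of_forall_list (fun m => m ∈ E)
    (fun l y => ∀ j ∈ Finset.range (l.length + 1), ∀ t ∈ T (l.take j),
      ‖Φ y t - Φ m₀ t‖ < 1 / ((l.length : ℝ) + 1)) (by
    intro l _
    have hev : ∀ᶠ y in 𝓝 m₀, ∀ j ∈ Finset.range (l.length + 1), ∀ t ∈ T (l.take j),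
        ‖Φ y t - Φ m₀ t‖ < 1 / ((l.length : ℝ) + 1) := by
      refine (eventually_all_finset _).2 fun j _ => (eventually_all_finset _).2 fun t _ => ?_
      have : Tendsto (fun y => ‖Φ y t - Φ m₀ t‖) (𝓝 m₀) (𝓝 ‖Φ m₀ t - Φ m₀ t‖) :=
        (((hP t).tendsto m₀).sub tendsto_const_nhds).norm
      rw [sub_self, norm_zero] at this
      exact this.eventually (gt_mem_nhds (hpos _))
    exact ((mem_closure_iff_frequently.1 hm₀).and_eventually hev).exists)
  refine ⟨e, fun n => (he n).1, fun k => ?_⟩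
  let L : ℕ → List P := fun n => (List.range n).map e
  choose t htT ht using fun n => hT (L n) k
  have hinv : Tendsto (fun n : ℕ => 1 / ((n : ℝ) + 1)) atTop (𝓝 0) :=
    tendsto_one_div_add_atTop_nhds_zero_nat
  have hlen : ∀ n, (L n).length = n := fun n => by simp [L]
  have ht₀ : Tendsto (fun j => Φ m₀ (t j)) atTop (𝓝 (Φ m₀ k)) := by
    rw [tendsto_iff_norm_sub_tendsto_zero]
    refine squeeze_zero (fun _ => norm_nonneg _) (fun j => ?_) hinv
    have := ht j m₀ (by simp)
    rw [hlen] at this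
    exact this.le
  have hte : ∀ i, Tendsto (fun j => Φ (e i) (t j)) atTop (𝓝 (Φ (e i) k)) := fun i => by
    rw [tendsto_iff_norm_sub_tendsto_zero]
    refine squeeze_zero' (.of_forall fun _ => norm_nonneg _) ?_ hinv
    filter_upwards [eventually_gt_atTop i] with j hj
    have := ht j (e i) (List.mem_cons_of_mem _ (List.mem_map_of_mem (List.mem_range.2 hj)))
    rw [hlen] at this
    exact this.le
  have het : ∀ j, Tendsto (fun n => Φ (e n) (t j)) atTop (𝓝 (Φ m₀ (t j))) := fun j => by
    rw [tendsto_iff_norm_sub_tendsto_zero]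
    refine squeeze_zero' (.of_forall fun _ => norm_nonneg _) ?_ hinv
    filter_upwards [eventually_ge_atTop j] with n hn
    have htake : (L n).take j = L j := by
      simp only [L, ← List.map_take, List.take_range, min_eq_left hn]
    have := (he n).2 j (by simp; omega) (t j) (by
      change t j ∈ T ((L n).take j)
      rw [htake]; exact htT j)
    simp only [List.length_map, List.length_range] at this
    exact this.le
  rw [tendsto_iff_ultrafilter]
  intro 𝒰 h𝒰
  obtain ⟨m', -, hm'⟩ := isCompact_univ.ultrafilter_le_nhds (𝒰.map e) (by simp)
  obtain ⟨t', -, ht'⟩ := isCompact_univ.ultrafilter_le_nhds (𝒰.map t) (by simp)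
  have hm : Tendsto e 𝒰 (𝓝 m') := hm'
  have htt : Tendsto t 𝒰 (𝓝 t') := ht'
  have e1 : ∀ i, Φ (e i) t' = Φ (e i) k := fun i =>
    tendsto_nhds_unique (((hK (e i)).tendsto t').comp htt) ((hte i).mono_left h𝒰)
  have e2 : Φ m₀ t' = Φ m₀ k :=
    tendsto_nhds_unique (((hK m₀).tendsto t').comp htt) (ht₀.mono_left h𝒰)
  have e3 : ∀ j, Φ m' (t j) = Φ m₀ (t j) := fun j =>
    tendsto_nhds_unique (((hP (t j)).tendsto m').comp hm) ((het j).mono_left h𝒰)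
  have e4 : Φ m' t' = Φ m₀ t' :=
    tendsto_nhds_unique (((hK m').tendsto t').comp htt)
      ((((hK m₀).tendsto t').comp htt).congr fun j => (e3 j).symm)
  have e5 : Tendsto (fun n => Φ (e n) k) 𝒰 (𝓝 (Φ m' t')) :=
    (((hP t').tendsto m').comp hm).congr e1
  rwa [e4, e2] at e5

end SequenceFromClosure

section WeakConvergence

variable {K : Type*} [TopologicalSpace K] [CompactSpace K] [T2Space K]

theorem tendsto_positive_functional {p : C(K, ℝ) →ₗ[ℝ] ℝ} (hp : ∀ h, 0 ≤ h → 0 ≤ p h)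
    {f : ℕ → C(K, ℝ)} {M : ℝ} (hM : ∀ n k, ‖f n k‖ ≤ M)
    (hf : ∀ k, Tendsto (fun n => f n k) atTop (𝓝 0)) :
    Tendsto (fun n => p (f n)) atTop (𝓝 0) := by
  let _ : MeasurableSpace K := borel K
  have : BorelSpace K := ⟨rfl⟩
  let c : C(K, ℝ) ≃ CompactlySupportedContinuousMap K ℝ :=
    CompactlySupportedContinuousMap.continuousMapEquiv
  let Λ : CompactlySupportedContinuousMap K ℝ →ₚ[ℝ] ℝ := PositiveLinearMap.mk₀
    { toFun := fun h => p h.toContinuousMap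
      map_add' := fun g h => p.map_add g.toContinuousMap h.toContinuousMap
      map_smul' := fun r h => p.map_smul r h.toContinuousMap }
    (fun h hh => hp _ hh)
  have hΛ : ∀ h : C(K, ℝ), p h = ∫ k, h k ∂(RealRMK.rieszMeasure Λ) := fun h =>
    (RealRMK.integral_rieszMeasure Λ (c h)).symm
  have hfin : MeasureTheory.IsFiniteMeasure (RealRMK.rieszMeasure Λ) := inferInstance
  simp only [hΛ]
  have := MeasureTheory.tendsto_integral_of_dominated_convergence (μ := RealRMK.rieszMeasure Λ)
    (F := fun n k => f n k) (f := fun _ => 0) (fun _ => M)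
    (fun n => (f n).continuous.aestronglyMeasurable) (MeasureTheory.integrable_const M)
    (fun n => .of_forall (hM n)) (.of_forall hf)
  simpa using this

/-- Bounded sequences converging to zero pointwise on a norm-determining compact space converge
weakly to zero. -/
theorem tendsto_functional_of_tendsto_pointwise {V : Type*} [NormedAddCommGroup V]
    [NormedSpace ℂ V] (j : V →ₗ[ℂ] C(K, ℂ)) (hj : ∀ v (M : ℝ), 0 ≤ M → (∀ k, ‖j v k‖ ≤ M) → ‖v‖ ≤ M)
    (n : V →L[ℂ] ℂ) {f : ℕ → V} {M : ℝ} (hM : ∀ i k, ‖j (f i) k‖ ≤ M)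
    (hf : ∀ k, Tendsto (fun i => j (f i) k) atTop (𝓝 0)) :
    Tendsto (fun i => n (f i)) atTop (𝓝 0) := by
  by_contra hcon
  obtain ⟨ε, hε, hfreq⟩ : ∃ ε > 0, ∃ᶠ i in atTop, ε ≤ ‖n (f i)‖ := by
    simpa [Metric.tendsto_nhds, Filter.Frequently] using hcon
  let absj : V → C(K, ℝ) := fun v => ⟨fun k => ‖j v k‖, (j v).continuous.norm⟩
  let δ : ℝ := ε / (‖n‖ + 1)
  have hδ : 0 < δ := by positivity
  let s : Set C(K, ℝ) := {h | ∀ k, h k < δ}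
  let t : Set C(K, ℝ) := {h | ∃ g : V, ε ≤ (n g).re ∧ ∀ k, ‖j g k‖ ≤ h k}
  have hs : Convex ℝ s := by
    intro x hx y hy a b ha hb hab k
    exact convex_Iio (𝕜 := ℝ) δ (hx k) (hy k) ha hb hab
  have hs' : IsOpen s := by
    have := ContinuousMap.isOpen_setOfPred_mapsTo (X := K) (Y := ℝ) isCompact_univ (isOpen_Iio (a := δ))
    convert this using 1
    ext h
    simp [s, Set.MapsTo]
  have ht : Convex ℝ t := by
    rintro x ⟨g, hg, hgx⟩ y ⟨g', hg', hgy⟩ a b ha hb hab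
    refine ⟨(a : ℂ) • g + (b : ℂ) • g', ?_, fun k => ?_⟩
    · simp only [map_add, map_smul, smul_eq_mul, Complex.add_re, Complex.re_ofReal_mul]
      calc ε = a * ε + b * ε := by rw [← add_mul, hab, one_mul]
        _ ≤ _ := by gcongr
    · simp only [map_add, map_smul, ContinuousMap.add_apply, ContinuousMap.smul_apply, smul_eq_mul]
      calc _ ≤ ‖(a : ℂ) * j g k‖ + ‖(b : ℂ) * j g' k‖ := norm_add_le _ _
        _ = a * ‖j g k‖ + b * ‖j g' k‖ := by
          simp [abs_of_nonneg ha, abs_of_nonneg hb]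
        _ ≤ _ := by gcongr; exacts [hgx k, hgy k]
  have hdisj : Disjoint s t := by
    rw [Set.disjoint_left]
    rintro h hh ⟨g, hg, hgh⟩
    have hg1 : ‖g‖ ≤ δ := hj g δ hδ.le fun k => (hgh k).trans (hh k).le
    have : ε ≤ ‖n‖ * δ := calc
      ε ≤ (n g).re := hg
      _ ≤ ‖n g‖ := Complex.re_le_norm _
      _ ≤ ‖n‖ * ‖g‖ := n.le_opNorm g
      _ ≤ ‖n‖ * δ := by gcongr
    have h2 : (‖n‖ + 1) * δ = ε := by
      simp only [δ]; field_simp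
    linarith
  obtain ⟨p, u, hps, hpt⟩ := geometric_hahn_banach_open hs hs' ht hdisj
  have hu : 0 < u := by simpa using hps 0 (fun k => hδ)
  have hp : ∀ h, 0 ≤ h → 0 ≤ p.toLinearMap h := by
    intro h hh
    by_contra! hneg
    have hneg' : p h < 0 := hneg
    have := hps ((u / p h) • h) (fun k => by
      have h1 : u / p h ≤ 0 := div_nonpos_of_nonneg_of_nonpos hu.le hneg'.le
      have h2 : 0 ≤ h k := hh k
      have : (u / p h) * h k ≤ 0 := mul_nonpos_of_nonpos_of_nonneg h1 h2
      exact this.trans_lt hδ)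
    rw [map_smul, smul_eq_mul, div_mul_cancel₀ _ hneg'.ne] at this
    exact lt_irrefl _ this
  have htend := tendsto_positive_functional hp (f := fun i => absj (f i)) (M := M)
    (fun i k => by simpa [absj] using hM i k)
    (fun k => by simpa [absj] using (hf k).norm)
  obtain ⟨i, hi, hi'⟩ := (hfreq.and_eventually (htend.eventually (gt_mem_nhds hu))).exists
  refine absurd (hpt (absj (f i)) ?_) (not_le.2 hi')
  have hne : n (f i) ≠ 0 := norm_pos_iff.1 (hε.trans_le hi)
  have hne' : (‖n (f i)‖ : ℂ) ≠ 0 := by simpa using hne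
  refine ⟨((starRingEnd ℂ) (n (f i)) / ‖n (f i)‖) • f i, ?_, fun k => ?_⟩
  · rw [map_smul, smul_eq_mul, div_mul_eq_mul_div, mul_comm, Complex.mul_conj,
      Complex.normSq_eq_norm_sq]
    have : ((‖n (f i)‖ ^ 2 : ℝ) : ℂ) / ‖n (f i)‖ = ((‖n (f i)‖ : ℝ) : ℂ) := by
      rw [Complex.ofReal_pow, sq, mul_div_assoc, div_self hne', mul_one]
    rw [this]
    simpa using hi
  · have : ‖n (f i)‖ ≠ 0 := by simpa using hne
    simp [absj, this]

end WeakConvergence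

section BidualPairing

variable {X Y : Type*} [NormedAddCommGroup X] [NormedSpace ℂ X]
  [NormedAddCommGroup Y] [NormedSpace ℂ Y]

/-- The weak-star closure in the bidual of a subset of a normed space. -/
def bidualClosure (D : Set X) : Set (WeakDual ℂ (X →L[ℂ] ℂ)) :=
  closure ((fun x => StrongDual.toWeakDual (NormedSpace.inclusionInDoubleDual ℂ X x)) '' D)

/-- A set on which the supremum of a functional is an upper bound for its norm. -/
def NormDetermining (D : Set X) : Prop :=
  ∀ (g : X →L[ℂ] ℂ) (M : ℝ), 0 ≤ M → (∀ x ∈ D, ‖g x‖ ≤ M) → ‖g‖ ≤ M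

/-- The two extensions to the biduals of a bounded bilinear form agree at `(m, n)`. -/
def ExtensionsAgree (φ : X →L[ℂ] Y →L[ℂ] ℂ) (m : (X →L[ℂ] ℂ) →L[ℂ] ℂ)
    (n : (Y →L[ℂ] ℂ) →L[ℂ] ℂ) : Prop :=
  m (n.comp φ) = n (m.comp φ.flip)

theorem bidualClosure_subset {D : Set X} {r : ℝ} (hD : ∀ x ∈ D, ‖x‖ ≤ r) :
    bidualClosure D ⊆ WeakDual.toStrongDual ⁻¹' Metric.closedBall 0 r := by
  refine closure_minimal ?_ (WeakDual.isClosed_closedBall 0 r)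
  rintro _ ⟨x, hx, rfl⟩
  exact (mem_closedBall_zero_iff (E := StrongDual ℂ (X →L[ℂ] ℂ))).2
    ((NormedSpace.double_dual_bound ℂ X x).trans (hD x hx))

theorem norm_le_of_mem_bidualClosure {D : Set X} {r : ℝ} (hD : ∀ x ∈ D, ‖x‖ ≤ r)
    {m : WeakDual ℂ (X →L[ℂ] ℂ)} (hm : m ∈ bidualClosure D) : ‖WeakDual.toStrongDual m‖ ≤ r :=
  (mem_closedBall_zero_iff (E := StrongDual ℂ (X →L[ℂ] ℂ))).1 (bidualClosure_subset hD hm)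

theorem isCompact_bidualClosure {D : Set X} {r : ℝ} (hD : ∀ x ∈ D, ‖x‖ ≤ r) :
    IsCompact (bidualClosure D) :=
  (WeakDual.isCompact_closedBall 0 r).of_isClosed_subset isClosed_closure (bidualClosure_subset hD)

theorem extensionsAgree_of_mem_bidualClosure {D : Set X} {D' : Set Y} {r r' : ℝ}
    (hD : ∀ x ∈ D, ‖x‖ ≤ r) (hD' : ∀ y ∈ D', ‖y‖ ≤ r') (hdet : NormDetermining D')
    {φ : X →L[ℂ] Y →L[ℂ] ℂ}
    (h : ∀ m ∈ bidualClosure D, ∀ n ∈ bidualClosure D',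
      ExtensionsAgree φ (WeakDual.toStrongDual m) (WeakDual.toStrongDual n))
    {m₀ : WeakDual ℂ (X →L[ℂ] ℂ)} (hm₀ : m₀ ∈ bidualClosure D) (n : (Y →L[ℂ] ℂ) →L[ℂ] ℂ) :
    ExtensionsAgree φ (WeakDual.toStrongDual m₀) n := by
  have : CompactSpace (bidualClosure D) := isCompact_iff_compactSpace.1 (isCompact_bidualClosure hD)
  have : CompactSpace (bidualClosure D') :=
    isCompact_iff_compactSpace.1 (isCompact_bidualClosure hD')
  let R : WeakDual ℂ (X →L[ℂ] ℂ) → (Y →L[ℂ] ℂ) := fun m => (WeakDual.toStrongDual m).comp φ.flip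
  let L : WeakDual ℂ (Y →L[ℂ] ℂ) → (X →L[ℂ] ℂ) := fun k => (WeakDual.toStrongDual k).comp φ
  let Φ : bidualClosure D → bidualClosure D' → ℂ := fun m k => k.1 (R m.1)
  have hΦ : ∀ m k, Φ m k = m.1 (L k.1) := fun m k => (h m.1 m.2 k.1 k.2).symm
  let j : (Y →L[ℂ] ℂ) →ₗ[ℂ] C(bidualClosure D', ℂ) :=
    { toFun := fun g => ⟨fun k => k.1 g, (WeakDual.eval_continuous g).comp continuous_subtype_val⟩
      map_add' := fun g g' => by ext k; exact map_add k.1 g g'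
      map_smul' := fun c g => by ext k; exact map_smul k.1 c g }
  have hj : ∀ v (M : ℝ), 0 ≤ M → (∀ k, ‖j v k‖ ≤ M) → ‖v‖ ≤ M := fun v M hM hv =>
    hdet v M hM fun y hy => hv ⟨_, subset_closure ⟨y, hy, rfl⟩⟩
  have hR : ∀ m ∈ bidualClosure D, ‖R m‖ ≤ r * ‖φ.flip‖ := fun m hm =>
    (ContinuousLinearMap.opNorm_comp_le _ _).trans (by
      gcongr
      exact norm_le_of_mem_bidualClosure hD hm)
  refine sub_eq_zero.1 (norm_le_zero_iff.1 (le_of_forall_pos_le_add fun ε hε => ?_))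
  rw [zero_add]
  let E : Set (bidualClosure D) := {m | (∃ x, ∀ f, m.1 f = f x) ∧
    ‖m₀ (n.comp φ) - m.1 (n.comp φ)‖ < ε}
  have hE : (⟨m₀, hm₀⟩ : bidualClosure D) ∈ closure E := by
    rw [closure_subtype]
    have hopen : IsOpen {m : WeakDual ℂ (X →L[ℂ] ℂ) | ‖m₀ (n.comp φ) - m (n.comp φ)‖ < ε} :=
      isOpen_lt (continuous_const.sub (WeakDual.eval_continuous _)).norm continuous_const
    have := hopen.inter_closure ⟨(by simpa using hε :
      m₀ ∈ {m : WeakDual ℂ (X →L[ℂ] ℂ) | ‖m₀ (n.comp φ) - m (n.comp φ)‖ < ε}), hm₀⟩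
    refine closure_mono ?_ this
    rintro _ ⟨hx, x, hxD, rfl⟩
    exact ⟨⟨_, subset_closure ⟨x, hxD, rfl⟩⟩, ⟨⟨x, fun f => rfl⟩, hx⟩, rfl⟩
  obtain ⟨e, heE, he⟩ := exists_seq_tendsto_of_mem_closure (Φ := Φ)
    (fun m => (WeakDual.eval_continuous _).comp continuous_subtype_val)
    (fun k => by
      simp only [hΦ]
      exact (WeakDual.eval_continuous _).comp continuous_subtype_val) hE
  have hlim := tendsto_functional_of_tendsto_pointwise j hj n
    (f := fun i => R m₀ - R (e i).1) (M := r' * (r * ‖φ.flip‖ + r * ‖φ.flip‖))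
    (fun i k => by
      have h1 : ‖R m₀ - R (e i).1‖ ≤ r * ‖φ.flip‖ + r * ‖φ.flip‖ :=
        (norm_sub_le _ _).trans (add_le_add (hR _ hm₀) (hR _ (e i).2))
      have h2 : ‖WeakDual.toStrongDual k.1‖ ≤ r' :=
        norm_le_of_mem_bidualClosure hD' k.2
      exact ((WeakDual.toStrongDual k.1).le_opNorm _).trans
        (mul_le_mul h2 h1 (norm_nonneg _) ((norm_nonneg (WeakDual.toStrongDual k.1)).trans h2)))
    (fun k => by
      have := (tendsto_const_nhds (x := Φ ⟨m₀, hm₀⟩ k)).sub (he k)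
      rw [sub_self] at this
      refine this.congr fun i => ?_
      exact (map_sub k.1 _ _).symm)
  have hlim' : Tendsto (fun i => (e i).1 (n.comp φ)) atTop (𝓝 (n (R m₀))) := by
    have := (tendsto_const_nhds (x := n (R m₀))).sub hlim
    rw [sub_zero] at this
    refine this.congr fun i => ?_
    rw [map_sub, sub_sub_cancel]
    obtain ⟨x, hx⟩ := (heE i).1
    rw [hx]
    change n (R (e i).1) = n (φ x)
    congr 1
    ext y
    exact hx (φ.flip y)
  exact le_of_tendsto ((tendsto_const_nhds (x := m₀ (n.comp φ))).sub hlim').norm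
    (.of_forall fun i => (heE i).2.le)

theorem WithSeminorms.exists_re_lt_of_notMem {E ι : Type*} [AddCommGroup E] [TopologicalSpace E]
    [IsTopologicalAddGroup E] [Module ℂ E] [ContinuousSMul ℂ E] [Module ℝ E] [IsScalarTower ℝ ℂ E]
    {p : SeminormFamily ℂ E ι} (hp : WithSeminorms p) {C : Set E} (hC : Convex ℝ C)
    (hC' : IsClosed C) {n : E} (hn : n ∉ C) :
    ∃ (F : StrongDual ℂ E) (u : ℝ), (∀ a ∈ C, (F a).re < u) ∧ u < (F n).re := by
  have : ContinuousSMul ℝ E := IsScalarTower.continuousSMul ℂ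
  have := hp.toLocallyConvexSpace
  exact RCLike.geometric_hahn_banach_closed_point (𝕜 := ℂ) hC hC' hn

theorem exists_eq_eval_of_strongDual_weakDual (F : StrongDual ℂ (WeakDual ℂ X)) :
    ∃ x, ∀ k : WeakDual ℂ X, F k = k x := by
  obtain ⟨x, hx⟩ := LinearMap.dualEmbedding_surjective (topDualPairing ℂ X) F
  exact ⟨x, fun k => (DFunLike.congr_fun hx k).symm⟩

theorem convex_bidualClosure {C : Set X} (hC : Convex ℝ C) : Convex ℝ (bidualClosure C) := by
  refine Convex.closure (𝕜 := ℝ) (E := WeakDual ℂ (X →L[ℂ] ℂ)) ?_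
  rintro _ ⟨x, hx, rfl⟩ _ ⟨y, hy, rfl⟩ a b ha hb hab
  refine ⟨a • x + b • y, hC hx hy ha hb hab, DFunLike.ext _ _ fun f => ?_⟩
  change f (a • x + b • y) = a • f x + b • f y
  rw [map_add, ContinuousLinearMap.map_smul_of_tower, ContinuousLinearMap.map_smul_of_tower]

theorem exists_re_lt_of_notMem_bidualClosure {C : Set X} (hC : Convex ℝ C)
    {n : WeakDual ℂ (X →L[ℂ] ℂ)} (hn : n ∉ bidualClosure C) :
    ∃ (g : X →L[ℂ] ℂ) (u : ℝ), (∀ x ∈ C, (g x).re < u) ∧ u < (n g).re := by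
  have : IsScalarTower ℝ ℂ (WeakDual ℂ (X →L[ℂ] ℂ)) :=
    ⟨fun a c f => ContinuousLinearMap.ext fun x => smul_assoc a c (f x)⟩
  obtain ⟨F, u, hF, hu⟩ := (WeakDual.withSeminorms ℂ (X →L[ℂ] ℂ)).exists_re_lt_of_notMem
    (convex_bidualClosure hC) isClosed_closure hn
  obtain ⟨g, hg⟩ := exists_eq_eval_of_strongDual_weakDual F
  refine ⟨g, u, fun x hx => ?_, ?_⟩
  · have := hF _ (subset_closure ⟨x, hx, rfl⟩)
    rw [hg] at this
    exact this
  · rwa [hg] at hu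

/-- Goldstine's theorem, up to an arbitrarily small enlargement of the ball. -/
theorem mem_bidualClosure_closedBall {n : WeakDual ℂ (X →L[ℂ] ℂ)} {r : ℝ}
    (hn : ‖WeakDual.toStrongDual n‖ < r) : n ∈ bidualClosure (Metric.closedBall (0 : X) r) := by
  have hr : 0 < r := (norm_nonneg (WeakDual.toStrongDual n)).trans_lt hn
  by_contra hcon
  obtain ⟨g, u, hF, hu⟩ := exists_re_lt_of_notMem_bidualClosure (convex_closedBall (0 : X) r) hcon
  have hball : ∀ x : X, ‖x‖ ≤ r → ‖g x‖ ≤ u := by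
    intro x hx
    by_cases h0 : g x = 0
    · have := hF 0 (by simpa using hr.le)
      rw [map_zero, Complex.zero_re] at this
      simpa [h0] using this.le
    have h0' : (‖g x‖ : ℂ) ≠ 0 := by simpa using h0
    have hx' : ((starRingEnd ℂ) (g x) / ‖g x‖) • x ∈ Metric.closedBall (0 : X) r := by
      have : ‖g x‖ ≠ 0 := by simpa using h0
      simpa [norm_smul, this] using hx
    have h2 : Complex.re (g (((starRingEnd ℂ) (g x) / ‖g x‖) • x)) < u :=
      hF _ hx'
    rw [map_smul, smul_eq_mul, div_mul_eq_mul_div, mul_comm, Complex.mul_conj,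
      Complex.normSq_eq_norm_sq, Complex.ofReal_pow, sq, mul_div_assoc, div_self h0', mul_one,
      Complex.ofReal_re] at h2
    exact h2.le
  have hu0 : 0 ≤ u := (norm_nonneg _).trans (hball 0 (by simpa using hr.le))
  have hg : ‖g‖ ≤ u / r :=
    ContinuousLinearMap.opNorm_bound_of_ball_bound hr u g fun x hx => hball x (by simpa using hx)
  have : Complex.re (n g) ≤ u := calc
    _ ≤ ‖n g‖ := Complex.re_le_norm _
    _ ≤ ‖WeakDual.toStrongDual n‖ * ‖g‖ := (WeakDual.toStrongDual n).le_opNorm g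
    _ ≤ r * (u / r) := by gcongr
    _ = u := by field_simp
  linarith

theorem extensionsAgree_of_normDetermining {D : Set X} {D' : Set Y} {r r' : ℝ}
    (hD : ∀ x ∈ D, ‖x‖ ≤ r) (hD' : ∀ y ∈ D', ‖y‖ ≤ r') (hdet : NormDetermining D)
    (hdet' : NormDetermining D') {φ : X →L[ℂ] Y →L[ℂ] ℂ}
    (h : ∀ m ∈ bidualClosure D, ∀ n ∈ bidualClosure D',
      ExtensionsAgree φ (WeakDual.toStrongDual m) (WeakDual.toStrongDual n))
    (m : (X →L[ℂ] ℂ) →L[ℂ] ℂ) (n : (Y →L[ℂ] ℂ) →L[ℂ] ℂ) : ExtensionsAgree φ m n := by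
  have hball : StrongDual.toWeakDual n ∈ bidualClosure (Metric.closedBall (0 : Y) (‖n‖ + 1)) :=
    mem_bidualClosure_closedBall (lt_add_one ‖n‖)
  exact (extensionsAgree_of_mem_bidualClosure (φ := φ.flip) (fun y hy => by simpa using hy) hD hdet
    (fun n' _ m' hm' => (extensionsAgree_of_mem_bidualClosure hD hD' hdet' h hm' _).symm)
    hball m).symm

theorem exists_ultrafilter_of_mem_bidualClosure_range {S : Type*} {δ : S → X}
    {m : WeakDual ℂ (X →L[ℂ] ℂ)} (hm : m ∈ bidualClosure (Set.range δ)) :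
    ∃ p : Ultrafilter S, ∀ f : X →L[ℂ] ℂ, Tendsto (fun s => f (δ s)) p (𝓝 (m f)) := by
  rw [bidualClosure, ← Set.range_comp, mem_closure_iff_frequently,
    ← comap_neBot_iff_frequently] at hm
  refine ⟨Ultrafilter.of (comap (((fun x => StrongDual.toWeakDual
    (NormedSpace.inclusionInDoubleDual ℂ X x))) ∘ δ) (𝓝 m)), fun f => ?_⟩
  have := (WeakDual.eval_continuous f).tendsto m
  exact this.comp (tendsto_comap.mono_left (Ultrafilter.of_le _))

theorem exists_bidual_limit {S : Type*} {δ : S → X} {r : ℝ} (hδ : ∀ s, ‖δ s‖ ≤ r)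
    (p : Ultrafilter S) :
    ∃ m : (X →L[ℂ] ℂ) →L[ℂ] ℂ, ∀ f : X →L[ℂ] ℂ, Tendsto (fun s => f (δ s)) p (𝓝 (m f)) := by
  let ι : S → WeakDual ℂ (X →L[ℂ] ℂ) := fun s =>
    StrongDual.toWeakDual (NormedSpace.inclusionInDoubleDual ℂ X (δ s))
  obtain ⟨m, -, hm⟩ := (isCompact_bidualClosure (D := Set.range δ) (r := r) (by
    rintro _ ⟨s, rfl⟩; exact hδ s)).ultrafilter_le_nhds (p.map ι)
    (Filter.le_principal_iff.2 (Filter.Eventually.of_forall (f := (p : Filter S)) fun s =>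
      subset_closure ⟨_, ⟨s, rfl⟩, rfl⟩))
  exact ⟨WeakDual.toStrongDual m, fun f =>
    ((WeakDual.eval_continuous f).tendsto m).comp (show Tendsto ι p (𝓝 m) from hm)⟩

end BidualPairing

section WeightedL1

variable {S : Type*} [Semigroup S] {w : S → ℝ} {B : Type*} [NonUnitalNormedRing B]
  [NormedSpace ℂ B] {δ : S → B}

theorem IsWeightedL1.norm_apply (h : IsWeightedL1 S w B δ) (s : S) : ‖δ s‖ = w s := by
  simpa using h.2.1 (Finsupp.single s 1)

theorem IsWeightedL1.norm_inv_smul (h : IsWeightedL1 S w B δ) (hw : ∀ s, 0 < w s) (s : S) :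
    ‖((w s)⁻¹ : ℂ) • δ s‖ = 1 := by
  simp [norm_smul, h.norm_apply, abs_of_pos (hw s), (hw s).ne']

theorem IsWeightedL1.opNorm_le (h : IsWeightedL1 S w B δ) {g : B →L[ℂ] ℂ} {M : ℝ} (hM : 0 ≤ M)
    (hg : ∀ s, ‖g (δ s)‖ ≤ M * w s) : ‖g‖ ≤ M := by
  refine g.opNorm_le_bound hM fun x => ?_
  refine h.2.2.induction_on (p := fun x => ‖g x‖ ≤ M * ‖x‖) x
    (isClosed_le (by fun_prop) (by fun_prop)) fun c => ?_
  rw [h.2.1 c, Finsupp.sum, Finsupp.sum, map_sum, Finset.mul_sum]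
  refine norm_sum_le_of_le _ fun s _ => ?_
  rw [map_smul, norm_smul, mul_left_comm]
  gcongr
  exact hg s

theorem IsWeightedL1.normDetermining (h : IsWeightedL1 S w B δ) (hw : ∀ s, 0 < w s) :
    NormDetermining (Set.range fun s => ((w s)⁻¹ : ℂ) • δ s) := by
  refine fun g M hM hg => h.opNorm_le hM fun s => ?_
  have := hg _ ⟨s, rfl⟩
  rw [map_smul, norm_smul, norm_inv, Complex.norm_real, Real.norm_of_nonneg (hw s).le,
    inv_mul_le_iff₀ (hw s)] at this
  linarith

theorem IsWeightedL1.exists_functional (h : IsWeightedL1 S (fun _ => 1) B δ) (c : S → ℂ)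
    (hc : ∀ s, ‖c s‖ ≤ 1) : ∃ g : B →L[ℂ] ℂ, ∀ s, g (δ s) = c s := by
  let T : (S →₀ ℂ) →ₗ[ℂ] B := Finsupp.linearCombination ℂ δ
  have hT : ∀ x, ‖T x‖ = x.sum fun _ c => ‖c‖ := fun x => by
    simpa [T, Finsupp.linearCombination_apply] using h.2.1 x
  have hinj : Function.Injective T := by
    refine (injective_iff_map_eq_zero T).2 fun x hx => ?_
    have h0 := hT x
    rw [hx, norm_zero, Finsupp.sum, eq_comm,
      Finset.sum_eq_zero_iff_of_nonneg fun _ _ => norm_nonneg _] at h0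
    ext s
    by_contra hs
    exact hs (norm_eq_zero.1 (h0 s (Finsupp.mem_support_iff.2 hs)))
  let e := LinearEquiv.ofInjective T hinj
  let f : LinearMap.range T →L[ℂ] ℂ :=
    ((Finsupp.linearCombination ℂ c).comp e.symm.toLinearMap).mkContinuous 1 fun y => by
      obtain ⟨x, rfl⟩ := e.surjective y
      have h1 : ‖e x‖ = x.sum fun _ c => ‖c‖ := hT x
      rw [one_mul, h1]
      simp only [LinearMap.comp_apply, LinearEquiv.coe_coe, LinearEquiv.symm_apply_apply,
        Finsupp.linearCombination_apply]
      refine norm_sum_le_of_le _ fun s _ => ?_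
      rw [norm_smul]
      exact mul_le_of_le_one_right (norm_nonneg _) (hc s)
  obtain ⟨g, hg, -⟩ := exists_extension_norm_eq (LinearMap.range T) f
  refine ⟨g, fun s => ?_⟩
  have hs : ((e (Finsupp.single s 1) : LinearMap.range T) : B) = δ s := by
    simp [e, T]
  rw [← hs, hg]
  simp [f]

variable [SMulCommClass ℂ B B] [IsScalarTower ℂ B B]

/-- The bilinear form `(a, b) ↦ f (a * b)`. -/
noncomputable def mulForm (f : B →L[ℂ] ℂ) : B →L[ℂ] B →L[ℂ] ℂ :=
  (ContinuousLinearMap.compL ℂ B B ℂ f).comp (ContinuousLinearMap.mul ℂ B)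

theorem arensRegular_iff_extensionsAgree :
    ArensRegular B ↔ ∀ m n (f : B →L[ℂ] ℂ), ExtensionsAgree (mulForm f) m n :=
  Iff.rfl

theorem ArensRegular.iteratedImagesEq (hreg : ArensRegular B)
    (h : IsWeightedL1 S (fun _ => 1) B δ) (p q : Ultrafilter S) :
    IteratedImagesEq (fun s t : S => s * t) p q := by
  classical
  have key : ∀ C : Set S, (∀ᶠ s in p, ∀ᶠ t in q, s * t ∈ C) →
      ¬ ∀ᶠ t in q, ∀ᶠ s in p, s * t ∈ Cᶜ := by
    intro C h1 h2
    obtain ⟨g, hg⟩ := h.exists_functional (C.indicator 1) fun s => by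
      by_cases hs : s ∈ C <;> simp [hs]
    obtain ⟨m, hm⟩ := exists_bidual_limit (fun s => (h.norm_apply s).le) p
    obtain ⟨n, hn⟩ := exists_bidual_limit (fun s => (h.norm_apply s).le) q
    have hmul : ∀ s t, g (δ s * δ t) = C.indicator 1 (s * t) := fun s t => by rw [h.1, hg]
    have hm1 : m (n.comp (mulForm g)) = 1 := by
      refine tendsto_nhds_unique_of_eventuallyEq (hm _) tendsto_const_nhds ?_
      filter_upwards [h1] with s hs
      refine tendsto_nhds_unique_of_eventuallyEq (hn _) tendsto_const_nhds ?_
      filter_upwards [hs] with t ht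
      exact (hmul s t).trans (by simp [ht])
    have hn0 : n (m.comp (mulForm g).flip) = 0 := by
      refine tendsto_nhds_unique_of_eventuallyEq (hn _) tendsto_const_nhds ?_
      filter_upwards [h2] with t ht
      refine tendsto_nhds_unique_of_eventuallyEq (hm _) tendsto_const_nhds ?_
      filter_upwards [ht] with s hs
      exact (hmul s t).trans (by simp [show s * t ∉ C from hs])
    have := arensRegular_iff_extensionsAgree.1 hreg m n g
    rw [ExtensionsAgree, hm1, hn0] at this
    exact one_ne_zero this
  intro C
  constructor
  · intro h1
    have := key C h1
    simpa only [Set.mem_compl_iff, Ultrafilter.eventually_not, not_not] using this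
  · intro h2
    by_contra h1
    refine key Cᶜ ?_ (by simpa only [compl_compl] using h2)
    simpa only [Set.mem_compl_iff, Ultrafilter.eventually_not] using h1

theorem trianglesMeet_of_iteratedImagesEq
    (h : ∀ p q : Ultrafilter S, IteratedImagesEq (fun s t : S => s * t) p q) :
    TrianglesMeet (fun s t : S => s * t) := by
  intro u v
  let C : Set S := {x | ∃ n m, n < m ∧ x = u n * v m}
  have hgt : ∀ n : ℕ, ∀ᶠ m in (hyperfilter ℕ : Filter ℕ), n < m := fun n =>
    Nat.hyperfilter_le_atTop (eventually_gt_atTop n)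
  have h1 : ∀ᶠ s in (hyperfilter ℕ).map u, ∀ᶠ t in (hyperfilter ℕ).map v, s * t ∈ C :=
    .of_forall (f := (hyperfilter ℕ : Filter ℕ)) fun n => (hgt n).mono fun m hm => ⟨n, m, hm, rfl⟩
  have h2 : ∀ᶠ m in (hyperfilter ℕ : Filter ℕ), ∀ᶠ n in (hyperfilter ℕ : Filter ℕ),
    u n * v m ∈ C := (h _ _ C).1 h1
  obtain ⟨l, hl⟩ := h2.exists
  obtain ⟨k, ⟨n, m, hnm, hk⟩, hlk⟩ := (hl.and (hgt l)).exists
  exact ⟨n, m, k, l, hnm, hlk, hk.symm⟩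

end WeightedL1

/-- Baker–Rejali: for a semigroup `S` with a weight `w` (`w(st) ≤ w(s)w(t)`),
if `ℓ¹(S)` is Arens regular then the weighted algebra `ℓ¹(S, w)` is Arens regular. -/
theorem weighted_l1_arens_regular_of_l1_arens_regular
    (S : Type*) [Semigroup S] (w : S → ℝ)
    (hw : ∀ s, 0 < w s) (hww : ∀ s t, w (s * t) ≤ w s * w t)
    (A : Type*) [NonUnitalNormedRing A] [NormedSpace ℂ A] [SMulCommClass ℂ A A]
    [IsScalarTower ℂ A A] [CompleteSpace A]
    (B : Type*) [NonUnitalNormedRing B] [NormedSpace ℂ B] [SMulCommClass ℂ B B]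
    [IsScalarTower ℂ B B] [CompleteSpace B]
    (δA : S → A) (δB : S → B)
    (hA : IsWeightedL1 S (fun _ => 1) A δA)
    (hB : IsWeightedL1 S w B δB)
    (hreg : ArensRegular A) : ArensRegular B := by
  have hI := hreg.iteratedImagesEq hA
  refine arensRegular_iff_extensionsAgree.2 fun m n f => ?_
  let δ : S → B := fun s => ((w s)⁻¹ : ℂ) • δB s
  have hδ : ∀ s, ‖δ s‖ = 1 := hB.norm_inv_smul hw
  have hbdd : ∀ x ∈ Set.range δ, ‖x‖ ≤ 1 := by
    rintro _ ⟨s, rfl⟩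
    exact (hδ s).le
  refine extensionsAgree_of_normDetermining hbdd hbdd (hB.normDetermining hw)
    (hB.normDetermining hw) (fun m hm n hn => ?_) m n
  obtain ⟨p, hp⟩ := exists_ultrafilter_of_mem_bidualClosure_range hm
  obtain ⟨q, hq⟩ := exists_ultrafilter_of_mem_bidualClosure_range hn
  have hf : ∀ s t, f (δ s * δ t) = (w s : ℂ)⁻¹ * (w t : ℂ)⁻¹ * f (δB (s * t)) := fun s t => by
    simp only [δ, smul_mul_smul_comm, hB.1, map_smul, smul_eq_mul]
  have hM : ∀ s t, ‖f (δ s * δ t)‖ ≤ ‖f‖ := fun s t => by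
    refine f.le_of_opNorm_le_of_le le_rfl (norm_mul_le _ _) |>.trans ?_
    rw [hδ, hδ, mul_one, mul_one]
  suffices ∃ u v : S → ℂ, (∀ᶠ s in p, ∀ᶠ t in q, f (δ s * δ t) = u s * v t) ∧
      ∀ᶠ t in q, ∀ᶠ s in p, f (δ s * δ t) = u s * v t by
    obtain ⟨u, v, h1, h2⟩ := this
    exact iterated_limits_eq_of_mul hM h1 h2 (fun s => hq (mulForm f (δ s)))
      (fun t => hp ((mulForm f).flip (δ t))) (hp _) (hq _)
  rcases eventuallyLeft_or_flip (trianglesMeet_of_iteratedImagesEq hI) (hI p q) with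
    ⟨a, h1, h2⟩ | ⟨b, h1, h2⟩
  · refine ⟨fun s => (w s : ℂ)⁻¹ * f (δB (a s)), fun t => (w t : ℂ)⁻¹,
      h1.mono fun s hs => hs.mono fun t ht => ?_, h2.mono fun t ht => ht.mono fun s hs => ?_⟩
    · rw [hf, show s * t = a s from ht, mul_right_comm]
    · rw [hf, show s * t = a s from hs, mul_right_comm]
  · refine ⟨fun s => (w s : ℂ)⁻¹, fun t => (w t : ℂ)⁻¹ * f (δB (b t)),
      h2.mono fun s hs => hs.mono fun t ht => ?_, h1.mono fun t ht => ht.mono fun s hs => ?_⟩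
    · rw [hf, show s * t = b t from ht, mul_assoc]
    · rw [hf, show s * t = b t from hs, mul_assoc]
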